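/- If G is a graph of tree-width t, then its Thue chromatic number satisfies π(G) ≤ 4^t. -/

import Mathlib

/-- A list `l` is a repetition if it is some nonempty block repeated twice. -/
def IsRepetition {α : Type*} (l : List α) : Prop :=
  ∃ w : List α, w ≠ [] ∧ l = w ++ w

/-- A vertex coloring `c` of a graph `G` is nonrepetitive if there is no path
`v₁, …, v_{2t}` in `G` such that `v_i` and `v_{t+i}` receive the same color for all
`i = 1, …, t`; equivalently, the color sequence along any path is not a repetition. -/
def NonrepColoring {V : Type*} {α : Type*} (G : SimpleGraph V) (c : V → α) : Prop :=
  ∀ (u v : V) (p : G.Walk u v), p.IsPath → ¬ IsRepetition (p.support.map c)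

/-- The Thue chromatic number of a graph `G`: the minimum number of colors needed in
a nonrepetitive coloring of `G`. -/
noncomputable def thueNumber {V : Type*} (G : SimpleGraph V) : ℕ :=
  sInf {n : ℕ | ∃ c : V → Fin n, NonrepColoring G c}

/-- A graph is chordal if every cycle on at least four vertices has a chord, i.e. an
edge of the graph joining two vertices of the cycle that is not an edge of the cycle. -/
def IsChordal {V : Type*} (G : SimpleGraph V) : Prop :=
  ∀ (v : V) (p : G.Walk v v), p.IsCycle → 4 ≤ p.length →
    ∃ u w : V, u ∈ p.support ∧ w ∈ p.support ∧ G.Adj u w ∧ s(u, w) ∉ p.edges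

/-- The tree-width of a graph `G`: the minimum integer `k` such that `G` is a
subgraph of a chordal graph with no clique on `k + 2` vertices. -/
noncomputable def treewidth {V : Type*} (G : SimpleGraph V) : ℕ :=
  sInf {k : ℕ | ∃ H : SimpleGraph V, G ≤ H ∧ IsChordal H ∧
    ∀ s : Finset V, H.IsClique (s : Set V) → s.card ≤ k + 1}

/-- The Thue–Morse sequence. -/
def thueMorse (n : ℕ) : Bool :=
  if n = 0 then false else xor (thueMorse (n / 2)) (n % 2 = 1)
termination_by n
decreasing_by omega

lemma thueMorse_two_mul (n : ℕ) : thueMorse (2 * n) = thueMorse n := by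
  rcases Nat.eq_zero_or_pos n with rfl | hn
  · rfl
  · rw [thueMorse, if_neg (by omega)]
    simp

lemma thueMorse_two_mul_add_one (n : ℕ) : thueMorse (2 * n + 1) = !thueMorse n := by
  rw [thueMorse, if_neg (by omega)]
  have h1 : (2 * n + 1) / 2 = n := by omega
  have h2 : (2 * n + 1) % 2 = 1 := by omega
  simp [h1, h2]

lemma thueMorse_even_succ {n : ℕ} (hn : n % 2 = 0) : thueMorse (n + 1) = !thueMorse n := by
  obtain ⟨k, rfl⟩ : ∃ k, n = 2 * k := ⟨n / 2, by omega⟩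
  rw [thueMorse_two_mul, thueMorse_two_mul_add_one]

/-- The Thue–Morse sequence is overlap-free. -/
lemma thueMorse_overlapFree (p : ℕ) (hp : 0 < p) (n : ℕ) :
    ¬ ∀ i ≤ p, thueMorse (n + i) = thueMorse (n + i + p) := by
  induction p using Nat.strong_induction_on generalizing n with
  | _ p ih =>
  intro h
  rcases Nat.even_or_odd' p with ⟨r, rfl | rfl⟩
  · refine ih r (by omega) (by omega) (n / 2) fun i hi => ?_
    have h1 := h (2 * i) (by omega)
    rcases Nat.even_or_odd' n with ⟨m, rfl | rfl⟩
    · rw [show 2 * m + 2 * i + 2 * r = 2 * (m + i + r) by ring,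
        show 2 * m + 2 * i = 2 * (m + i) by ring, thueMorse_two_mul, thueMorse_two_mul] at h1
      rwa [show 2 * m / 2 = m by omega]
    · rw [show 2 * m + 1 + 2 * i + 2 * r = 2 * (m + i + r) + 1 by ring,
        show 2 * m + 1 + 2 * i = 2 * (m + i) + 1 by ring, thueMorse_two_mul_add_one,
        thueMorse_two_mul_add_one, Bool.not_inj_iff] at h1
      rwa [show (2 * m + 1) / 2 = m by omega]
  · have alt : ∀ i ≤ 2 * r + 1, thueMorse (n + i) = xor (thueMorse n) (i % 2 = 1) := by
      intro i
      induction i with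
      | zero => simp
      | succ i ihi =>
        intro hi
        have h1 := ihi (by omega)
        have h2 : thueMorse (n + i + 1) = !thueMorse (n + i) := by
          rcases Nat.mod_two_eq_zero_or_one (n + i) with h0 | h0
          · exact thueMorse_even_succ h0
          · have h3 := h i (by omega)
            have h4 := h (i + 1) hi
            rw [← add_assoc] at h4
            rw [h4, h3, show n + i + 1 + (2 * r + 1) = n + i + (2 * r + 1) + 1 by ring,
              thueMorse_even_succ (by omega)]
        rw [← add_assoc, h2, h1]
        rcases Nat.mod_two_eq_zero_or_one i with h0 | h0
        · simp [h0, show (i + 1) % 2 = 1 by omega]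
        · simp [h0, show (i + 1) % 2 = 0 by omega]
    have h1 := alt (2 * r + 1) le_rfl
    have h2 := h 0 (by omega)
    rw [add_zero, h1] at h2
    simp [show (2 * r + 1) % 2 = 1 by omega] at h2

/-- The ternary Thue–Morse word: the first differences of the Thue–Morse sequence. -/
def ternaryThue (n : ℕ) : ℤ := (thueMorse (n + 1)).toNat - (thueMorse n).toNat

lemma ternaryThue_squareFree (p : ℕ) (hp : 0 < p) (n : ℕ) :
    ¬ ∀ i < p, ternaryThue (n + i) = ternaryThue (n + i + p) := by
  intro h
  let D : ℕ → ℤ := fun i => (thueMorse (n + i + p)).toNat - (thueMorse (n + i)).toNat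
  have hD : ∀ i ≤ p, D i = D 0 := by
    intro i
    induction i with
    | zero => simp
    | succ i ih =>
      intro hi
      rw [← ih (by omega)]
      have h1 := h i (by omega)
      simp only [ternaryThue] at h1
      simp only [D]
      rw [show n + (i + 1) + p = n + i + p + 1 by ring, show n + (i + 1) = n + i + 1 by ring]
      linarith
  have hb : ∀ b : Bool, b.toNat ≤ 1 := by decide
  have h0 : D 0 = 0 := by
    have h1 := hD p le_rfl
    have h2 := hb (thueMorse n)
    have h3 := hb (thueMorse (n + p + p))
    simp only [D, add_zero] at h1 ⊢
    omega
  refine thueMorse_overlapFree p hp n fun i hi => ?_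
  have h1 := hD i hi
  rw [h0] at h1
  simp only [D] at h1
  have : (thueMorse (n + i)).toNat = (thueMorse (n + i + p)).toNat := by omega
  revert this
  cases thueMorse (n + i) <;> cases thueMorse (n + i + p) <;> simp

lemma ternaryThue_mem (n : ℕ) : -1 ≤ ternaryThue n ∧ ternaryThue n ≤ 1 := by
  have hb : ∀ b : Bool, b.toNat ≤ 1 := by decide
  have h1 := hb (thueMorse n)
  have h2 := hb (thueMorse (n + 1))
  simp only [ternaryThue]
  omega

/-- A sequence is palindrome-free if any three consecutive letters are pairwise distinct. -/
def IsPalindromeFreeSeq {α : Type*} (q : ℕ → α) : Prop :=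
  ∀ a b, a ≤ b + 2 → b ≤ a + 2 → q a = q b → a = b

/-- A sequence is square-free if no nonempty block is immediately repeated. -/
def IsSquareFreeSeq {α : Type*} (q : ℕ → α) : Prop :=
  ∀ p, 0 < p → ∀ n, ¬ ∀ i < p, q (n + i) = q (n + i + p)

/-- The ternary Thue–Morse word with a fourth letter inserted after every second letter. -/
def quaternaryThue (n : ℕ) : ℤ :=
  if n % 3 = 2 then 2 else ternaryThue (2 * (n / 3) + n % 3)

lemma quaternaryThue_eq_two_iff (n : ℕ) : quaternaryThue n = 2 ↔ n % 3 = 2 := by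
  have := ternaryThue_mem (2 * (n / 3) + n % 3)
  unfold quaternaryThue
  split_ifs with h <;> simp [h]
  omega

lemma ternaryThue_succ_ne (n : ℕ) : ternaryThue n ≠ ternaryThue (n + 1) := by
  intro h
  refine ternaryThue_squareFree 1 one_pos n fun i hi => ?_
  obtain rfl : i = 0 := by omega
  simpa using h

lemma quaternaryThue_palindromeFree : IsPalindromeFreeSeq quaternaryThue := by
  have key : ∀ a b, a < b → b ≤ a + 2 → quaternaryThue a ≠ quaternaryThue b := by
    intro a b hab hba h
    have h2 := quaternaryThue_eq_two_iff a
    rw [h, quaternaryThue_eq_two_iff] at h2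
    have ha : a % 3 ≠ 2 := by omega
    have hb : b % 3 ≠ 2 := by omega
    rw [quaternaryThue, quaternaryThue, if_neg ha, if_neg hb] at h
    rw [show 2 * (b / 3) + b % 3 = 2 * (a / 3) + a % 3 + 1 by omega] at h
    exact ternaryThue_succ_ne _ h
  intro a b h1 h2 h
  rcases lt_trichotomy a b with h3 | h3 | h3
  · exact (key a b h3 h2 h).elim
  · exact h3
  · exact (key b a h3 h1 h.symm).elim

lemma quaternaryThue_squareFree : IsSquareFreeSeq quaternaryThue := by
  intro p hp n h
  rcases lt_or_ge p 3 with h3 | h3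
  · have := quaternaryThue_palindromeFree _ _ (by omega) (by omega) (h 0 hp)
    omega
  have hmod : p % 3 = 0 := by
    have h1 := h ((2 * n + 2) % 3) (by omega)
    have h2 := quaternaryThue_eq_two_iff (n + (2 * n + 2) % 3)
    rw [h1, quaternaryThue_eq_two_iff] at h2
    omega
  refine ternaryThue_squareFree (2 * (p / 3)) (by omega) (2 * (n / 3) + n % 3) fun i hi => ?_
  let j := 2 * (n / 3) + n % 3 + i
  let z := 3 * (j / 2) + j % 2
  have hq : ∀ a, quaternaryThue (3 * (a / 2) + a % 2) = ternaryThue a := by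
    intro a
    rw [quaternaryThue, if_neg (by omega)]
    congr 1
    omega
  have h1 := h (z - n) (by omega)
  rw [show n + (z - n) = z by omega,
    show z + p = 3 * ((j + 2 * (p / 3)) / 2) + (j + 2 * (p / 3)) % 2 by omega, hq, hq] at h1
  exact h1

lemma exists_fin_four_squareFree :
    ∃ q : ℕ → Fin 4, IsPalindromeFreeSeq q ∧ IsSquareFreeSeq q := by
  have hb : ∀ n, -1 ≤ quaternaryThue n ∧ quaternaryThue n ≤ 2 := by
    intro n
    have := ternaryThue_mem (2 * (n / 3) + n % 3)
    unfold quaternaryThue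
    split_ifs <;> omega
  have key : ∀ a b, (⟨(quaternaryThue a + 1).toNat, by have := hb a; omega⟩ : Fin 4) =
      ⟨(quaternaryThue b + 1).toNat, by have := hb b; omega⟩ →
      quaternaryThue a = quaternaryThue b := by
    intro a b h
    have h1 := hb a
    have h2 := hb b
    rw [Fin.mk.injEq] at h
    omega
  refine ⟨fun n => ⟨(quaternaryThue n + 1).toNat, by have := hb n; omega⟩, ?_, ?_⟩
  · intro a b h1 h2 h
    exact quaternaryThue_palindromeFree a b h1 h2 (key _ _ h)
  · intro p hp n h
    exact quaternaryThue_squareFree p hp n fun i hi => key _ _ (h i hi)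

lemma exists_eq_of_lazy_walk {f : ℕ → ℕ} {i j : ℕ} (hij : i ≤ j)
    (hf : ∀ k, i ≤ k → k < j → f (k + 1) ≤ f k + 1 ∧ f k ≤ f (k + 1) + 1) {z : ℕ}
    (hz : (f i ≤ z ∧ z ≤ f j) ∨ (f j ≤ z ∧ z ≤ f i)) : ∃ k, i ≤ k ∧ k ≤ j ∧ f k = z := by
  induction j, hij using Nat.le_induction with
  | base => exact ⟨i, le_rfl, le_rfl, by omega⟩
  | succ j hij ih =>
    by_cases h : f (j + 1) = z
    · exact ⟨j + 1, by omega, le_rfl, h⟩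
    · have := hf j hij (by omega)
      obtain ⟨k, h1, h2, h3⟩ := ih (fun k h1 h2 => hf k h1 (by omega)) (by omega)
      exact ⟨k, h1, by omega, h3⟩

/-- Two lazy walks on the naturals with the same color sequence under a palindrome-free coloring
differ by a translation or by a reflection. -/
lemma lazy_walk_translation_or_reflection {α : Type*} {q : ℕ → α} (hq : IsPalindromeFreeSeq q)
    {x y : ℕ → ℕ} {m : ℕ}
    (hx : ∀ i, i + 1 < m → x (i + 1) ≤ x i + 1 ∧ x i ≤ x (i + 1) + 1)
    (hy : ∀ i, i + 1 < m → y (i + 1) ≤ y i + 1 ∧ y i ≤ y (i + 1) + 1)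
    (h : ∀ i < m, q (x i) = q (y i)) :
    (∀ i < m, y i + x 0 = x i + y 0) ∨ (∀ i < m, y i + x i = x 0 + y 0) := by
  suffices H : ∀ n, n + 1 ≤ m → (∀ i < n + 1, y i + x 0 = x i + y 0) ∨
      (∀ i < n + 1, y i + x i = x 0 + y 0) by
    rcases m with _ | m
    · simp
    · exact H m le_rfl
  intro n
  induction n with
  | zero =>
    intro _
    left
    intro i hi
    obtain rfl : i = 0 := by omega
    omega
  | succ n ih =>
    intro hn
    have ih := ih (by omega)
    have sx := hx n (by omega)
    have sy := hy n (by omega)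
    have c0 := h n (by omega)
    have c1 := h (n + 1) (by omega)
    have extend : ((∀ i < n + 1, y i + x 0 = x i + y 0) ∧ y (n + 1) + x 0 = x (n + 1) + y 0) ∨
        ((∀ i < n + 1, y i + x i = x 0 + y 0) ∧ y (n + 1) + x (n + 1) = x 0 + y 0) →
        (∀ i < n + 1 + 1, y i + x 0 = x i + y 0) ∨ (∀ i < n + 1 + 1, y i + x i = x 0 + y 0) := by
      rintro (⟨h1, h2⟩ | ⟨h1, h2⟩)
      · left
        intro i hi
        rcases Nat.lt_succ_iff_lt_or_eq.1 hi with h3 | rfl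
        exacts [h1 i h3, h2]
      · right
        intro i hi
        rcases Nat.lt_succ_iff_lt_or_eq.1 hi with h3 | rfl
        exacts [h1 i h3, h2]
    apply extend
    by_cases A : ∃ j < n + 1, x j = x (n + 1)
    · obtain ⟨j, hj, hxj⟩ := A
      have cj := h j (by omega)
      have e : q (y j) = q (y (n + 1)) := by rw [← cj, ← c1, hxj]
      rcases ih with ih | ih
      · refine Or.inl ⟨ih, ?_⟩
        have i1 := ih j hj
        have i2 := ih n (by omega)
        have := hq _ _ (by omega) (by omega) e
        omega
      · refine Or.inr ⟨ih, ?_⟩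
        have i1 := ih j hj
        have i2 := ih n (by omega)
        have := hq _ _ (by omega) (by omega) e
        omega
    have hne : x n ≠ x (n + 1) := fun e => A ⟨n, by omega, e⟩
    have hyne : y n ≠ y (n + 1) := by
      intro e
      exact hne (hq _ _ (by omega) (by omega) (by rw [c0, c1, e]))
    by_cases B : ∃ j < n + 1, x j + x (n + 1) = 2 * x n
    · obtain ⟨j, hj, hxj⟩ := B
      have cj := h j (by omega)
      have hne2 : y j ≠ y (n + 1) := by
        intro e
        have := hq (x j) (x (n + 1)) (by omega) (by omega) (by rw [cj, c1, e])
        omega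
      rcases ih with ih | ih
      · refine Or.inl ⟨ih, ?_⟩
        have i1 := ih j hj
        have i2 := ih n (by omega)
        omega
      · refine Or.inr ⟨ih, ?_⟩
        have i1 := ih j hj
        have i2 := ih n (by omega)
        omega
    have const : ∀ j < n + 1, x j = x n := by
      intro j hj
      by_contra hjn
      rcases Nat.lt_or_gt_of_ne hjn with hlt | hlt
      · obtain ⟨k, h1, h2, h3⟩ := exists_eq_of_lazy_walk (f := x) (i := j) (j := n) (by omega)
          (fun k _ _ => hx k (by omega)) (z := x n - 1) (by omega)
        rcases lt_or_ge (x n) (x (n + 1)) with h4 | h4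
        · exact B ⟨k, by omega, by omega⟩
        · exact A ⟨k, by omega, by omega⟩
      · obtain ⟨k, h1, h2, h3⟩ := exists_eq_of_lazy_walk (f := x) (i := j) (j := n) (by omega)
          (fun k _ _ => hx k (by omega)) (z := x n + 1) (by omega)
        rcases lt_or_ge (x n) (x (n + 1)) with h4 | h4
        · exact A ⟨k, by omega, by omega⟩
        · exact B ⟨k, by omega, by omega⟩
    have const0 := const 0 (by omega)
    have ih1 : ∀ i < n + 1, y i = y 0 := by
      intro i hi
      have := const i hi
      rcases ih with ih | ih
      · have := ih i hi; omega
      · have := ih i hi; omega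
    have hyn := ih1 n (by omega)
    by_cases C : y (n + 1) + x 0 = x (n + 1) + y 0
    · refine Or.inl ⟨fun i hi => ?_, C⟩
      have := const i hi
      have := ih1 i hi
      omega
    · refine Or.inr ⟨fun i hi => ?_, by omega⟩
      have := const i hi
      have := ih1 i hi
      omega

/-- If a lazy walk on the naturals is colored repetitively by a square-free palindrome-free
sequence, then the walk itself is a repetition. -/
lemma lazy_walk_repetition {α : Type*} {q : ℕ → α} (hq : IsPalindromeFreeSeq q)
    (hs : IsSquareFreeSeq q) {f : ℕ → ℕ} {m : ℕ}
    (hf : ∀ i, i + 1 < 2 * m → f (i + 1) ≤ f i + 1 ∧ f i ≤ f (i + 1) + 1)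
    (h : ∀ i < m, q (f i) = q (f (i + m))) : ∀ i < m, f i = f (i + m) := by
  rcases Nat.eq_zero_or_pos m with rfl | hm
  · simp
  have hy : ∀ i, i + 1 < m → f (i + 1 + m) ≤ f (i + m) + 1 ∧ f (i + m) ≤ f (i + 1 + m) + 1 := by
    intro i hi
    rw [show i + 1 + m = i + m + 1 by ring]
    exact hf _ (by omega)
  have mid : f m ≤ f (m - 1) + 1 ∧ f (m - 1) ≤ f m + 1 := by
    have := hf (m - 1) (by omega)
    rwa [show m - 1 + 1 = m by omega] at this
  have ivt : ∀ z, (f 0 ≤ z ∧ z ≤ f (m - 1)) ∨ (f (m - 1) ≤ z ∧ z ≤ f 0) →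
      ∃ k < m, f k = z := by
    intro z hz
    obtain ⟨k, _, h2, h3⟩ := exists_eq_of_lazy_walk (f := f) (Nat.zero_le (m - 1))
      (fun k _ _ => hf k (by omega)) hz
    exact ⟨k, by omega, h3⟩
  rcases lazy_walk_translation_or_reflection hq (x := f) (y := fun i => f (i + m))
    (fun i hi => hf i (by omega)) hy h with T | R
  · simp only [zero_add] at T
    rcases lt_trichotomy (f 0) (f m) with h0 | h0 | h0
    · refine (hs (f m - f 0) (by omega) (f 0) fun i hi => ?_).elim
      obtain ⟨k, hk, hkz⟩ := ivt (f 0 + i) (by omega)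
      have h1 := T k hk
      have h2 := h k hk
      rwa [hkz, show f (k + m) = f 0 + i + (f m - f 0) by omega] at h2
    · intro i hi
      have := T i hi
      omega
    · refine (hs (f 0 - f m) (by omega) (f m + 1 - (f 0 - f m)) fun i hi => ?_).elim
      obtain ⟨k, hk, hkz⟩ := ivt (f m + 1 + i) (by omega)
      obtain ⟨k', hk', hkz'⟩ := ivt (f m + 1) (by omega)
      have h0 := T k' hk'
      have h1 := T k hk
      have h2 := h k hk
      rw [hkz, show f (k + m) = f m + 1 - (f 0 - f m) + i by omega] at h2
      rw [← h2]
      congr 1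
      omega
  · simp only [zero_add] at R
    by_cases e : f 0 = f (m - 1)
    · have h2 := h 0 hm
      rw [zero_add] at h2
      have h3 := hq _ _ (by omega) (by omega) h2
      have adj : ∀ i < m, f i = f (i + m) := by
        intro i
        induction i with
        | zero => simpa using fun _ => h3
        | succ i ih =>
          intro hi
          have h4 := ih (by omega)
          have h5 := hf i (by omega)
          have h6 := hy i hi
          exact hq _ _ (by omega) (by omega) (h _ hi)
      exact adj
    · exfalso
      have key : ∀ z, (f 0 ≤ z ∧ z ≤ f (m - 1)) ∨ (f (m - 1) ≤ z ∧ z ≤ f 0) →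
          2 * z ≤ f 0 + f m + 2 → f 0 + f m ≤ 2 * z + 2 → 2 * z = f 0 + f m := by
        intro z hz h1 h2
        obtain ⟨k, hk, rfl⟩ := ivt z hz
        have h3 := R k hk
        have := hq _ _ (by omega) (by omega) (h k hk)
        omega
      have k1 := key ((f 0 + f (m - 1)) / 2) (by omega) (by omega) (by omega)
      have k2 := key ((f 0 + f (m - 1)) / 2 + 1) (by omega) (by omega) (by omega)
      omega

/-- The graph `G` with only the edges inside `S` kept. -/
def restrictTo {V : Type*} (G : SimpleGraph V) (S : Set V) : SimpleGraph V where
  Adj x y := G.Adj x y ∧ x ∈ S ∧ y ∈ S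
  symm := ⟨fun _ _ h => ⟨h.1.symm, h.2.2, h.2.1⟩⟩
  loopless := ⟨fun _ h => h.1.ne rfl⟩

lemma restrictTo_le {V : Type*} (G : SimpleGraph V) (S : Set V) : restrictTo G S ≤ G :=
  fun _ _ h => h.1

lemma mem_of_mem_support_restrictTo {V : Type*} {G : SimpleGraph V} {S : Set V} {u v : V}
    (hu : u ∈ S) (p : (restrictTo G S).Walk u v) : ∀ x ∈ p.support, x ∈ S := by
  induction p with
  | nil => simpa using hu
  | cons h p ih =>
    intro x hx
    rw [SimpleGraph.Walk.support_cons, List.mem_cons] at hx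
    rcases hx with rfl | hx
    · exact hu
    · exact ih h.2.2 x hx

/-- A shortest walk has no chords. -/
lemma mem_edges_of_length_eq_dist {V : Type*} {G : SimpleGraph V} {u v : V} {p : G.Walk u v}
    (hp : p.length = G.dist u v) {x y : V} (hx : x ∈ p.support) (hy : y ∈ p.support)
    (hxy : G.Adj x y) : s(x, y) ∈ p.edges := by
  obtain ⟨i, rfl, hi⟩ := SimpleGraph.Walk.mem_support_iff_exists_getVert.1 hx
  obtain ⟨j, rfl, hj⟩ := SimpleGraph.Walk.mem_support_iff_exists_getVert.1 hy
  have key : ∀ i j, i < j → j ≤ p.length → G.Adj (p.getVert i) (p.getVert j) →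
      s(p.getVert i, p.getVert j) ∈ p.edges := by
    intro i j hij hj hadj
    have h1 := SimpleGraph.dist_le ((p.take i).append (SimpleGraph.Walk.cons hadj (p.drop j)))
    simp only [SimpleGraph.Walk.length_append, SimpleGraph.Walk.length_cons,
      SimpleGraph.Walk.take_length, SimpleGraph.Walk.drop_length] at h1
    obtain rfl : j = i + 1 := by omega
    rw [SimpleGraph.Walk.mk_mem_edges_iff_exists]
    exact ⟨i, by omega, rfl⟩
  rcases lt_trichotomy i j with h | h | h
  · exact key i j h hj hxy
  · subst h
    exact (hxy.ne rfl).elim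
  · rw [Sym2.eq_swap]
    exact key j i h hi hxy.symm

/-- In a chordal graph, two non-adjacent vertices are not joined by two paths through sets of
vertices that are disjoint and non-adjacent. -/
lemma IsChordal.adj_of_reachable {V : Type*} {G : SimpleGraph V} (hG : IsChordal G) {u v : V}
    (huv : u ≠ v) {A B : Set V} (hAB : ∀ a ∈ A, ∀ b ∈ B, a ≠ b ∧ ¬ G.Adj a b)
    (huA : u ∉ A) (huB : u ∉ B) (hvA : v ∉ A) (hvB : v ∉ B)
    (hA : (restrictTo G (A ∪ {u, v})).Reachable u v)
    (hB : (restrictTo G (B ∪ {u, v})).Reachable u v) : G.Adj u v := by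
  classical
  by_contra hn
  obtain ⟨p, hp, hpl⟩ := hA.exists_path_of_dist
  obtain ⟨r, hr, hrl⟩ := hB.exists_path_of_dist
  have hpS := mem_of_mem_support_restrictTo (by simp) p
  have hrS := mem_of_mem_support_restrictTo (by simp) r
  have hp2 : 2 ≤ p.length := by
    rw [hpl]
    exact hA.one_lt_dist_of_ne_of_not_adj huv fun h => hn h.1
  have hr2 : 2 ≤ r.length := by
    rw [hrl]
    exact hB.one_lt_dist_of_ne_of_not_adj huv fun h => hn h.1
  let p' := p.mapLe (restrictTo_le G _)
  let r' := r.mapLe (restrictTo_le G _)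
  have ps : p'.support = p.support := by simp [p']
  have rs : r'.support = r.support := by simp [r']
  have pe : p'.edges = p.edges := by simp [p']
  have re : r'.edges = r.edges := by simp [r']
  have hp' : p'.IsPath := by rw [SimpleGraph.Walk.isPath_def, ps]; exact hp.support_nodup
  have hr' : r'.IsPath := by rw [SimpleGraph.Walk.isPath_def, rs]; exact hr.support_nodup
  have pl : p'.length = p.length := by simp [p']
  have rl : r'.length = r.length := by simp [r']
  have hcyc : (p'.append r'.reverse).IsCycle := by
    have hdisj : ∀ x ∈ p'.support, x ∈ r'.support → x = u ∨ x = v := by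
      intro x h1 h2
      rw [ps] at h1
      rw [rs] at h2
      rcases hpS x h1 with h3 | h3
      · rcases hrS x h2 with h4 | h4
        · exact ((hAB x h3 x h4).1 rfl).elim
        · exact h4
      · exact h3
    clear_value p' r'
    cases p' with
    | nil => exact (huv rfl).elim
    | @cons _ w _ h p1 =>
      rw [SimpleGraph.Walk.cons_append, SimpleGraph.Walk.cons_isCycle_iff]
      rw [SimpleGraph.Walk.cons_isPath_iff] at hp'
      have hwv : w ≠ v := fun e => hn (e ▸ h)
      have hwr : w ∉ r'.support := fun e => by
        rcases hdisj w (by simp) e with h1 | h1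
        · exact h.ne h1.symm
        · exact hwv h1
      constructor
      · rw [SimpleGraph.Walk.isPath_def, SimpleGraph.Walk.support_append, List.nodup_append]
        have hrn : r'.reverse.support.Nodup := hr'.reverse.support_nodup
        refine ⟨hp'.1.support_nodup, hrn.tail, ?_⟩
        rintro a ha b hb rfl
        have hb' : a ∈ r'.support := by
          have := List.mem_of_mem_tail hb
          simpa using this
        rcases hdisj a (by simp [ha]) hb' with rfl | rfl
        · exact hp'.2 ha
        · rw [← SimpleGraph.Walk.cons_tail_support r'.reverse] at hrn
          exact (List.nodup_cons.1 hrn).1 hb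
      · rw [SimpleGraph.Walk.edges_append, List.mem_append, not_or]
        refine ⟨fun e => hp'.2 (p1.fst_mem_support_of_mem_edges e), fun e => hwr ?_⟩
        have := r'.reverse.snd_mem_support_of_mem_edges e
        simpa using this
  obtain ⟨x, y, hx, hy, hxy, hne⟩ := hG u _ hcyc (by
    rw [SimpleGraph.Walk.length_append, SimpleGraph.Walk.length_reverse]
    omega)
  rw [SimpleGraph.Walk.mem_support_append_iff, SimpleGraph.Walk.support_reverse,
    List.mem_reverse, ps, rs] at hx hy
  rw [SimpleGraph.Walk.edges_append, SimpleGraph.Walk.edges_reverse, List.mem_append,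
    List.mem_reverse, pe, re, not_or] at hne
  have inA : ∀ z, z ∈ A ∪ {u, v} → z ∈ p.support ∨ z ∈ r.support → z ∈ p.support := by
    intro z h1 h2
    rcases h2 with h2 | h2
    · exact h2
    · rcases hrS z h2 with h3 | h3
      · rcases h1 with h1 | rfl | rfl
        · exact ((hAB z h1 z h3).1 rfl).elim
        · simp
        · simp
      · rcases h3 with rfl | rfl <;> simp
  have inB : ∀ z, z ∈ B ∪ {u, v} → z ∈ p.support ∨ z ∈ r.support → z ∈ r.support := by
    intro z h1 h2
    rcases h2 with h2 | h2
    · rcases hpS z h2 with h3 | h3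
      · rcases h1 with h1 | rfl | rfl
        · exact ((hAB z h3 z h1).1 rfl).elim
        · simp
        · simp
      · rcases h3 with rfl | rfl <;> simp
    · exact h2
  by_cases cA : x ∈ A ∪ {u, v} ∧ y ∈ A ∪ {u, v}
  · exact hne.1 (mem_edges_of_length_eq_dist hpl (inA x cA.1 hx) (inA y cA.2 hy) ⟨hxy, cA⟩)
  by_cases cB : x ∈ B ∪ {u, v} ∧ y ∈ B ∪ {u, v}
  · exact hne.2 (mem_edges_of_length_eq_dist hrl (inB x cB.1 hx) (inB y cB.2 hy) ⟨hxy, cB⟩)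
  have all : ∀ z, z ∈ p.support ∨ z ∈ r.support → z ∈ A ∪ {u, v} ∨ z ∈ B ∪ {u, v} :=
    fun z hz => hz.imp (hpS z) (hrS z)
  have cross : ∀ a b, a ∈ A ∪ {u, v} → b ∈ B ∪ {u, v} → b ∉ A ∪ {u, v} → a ∉ B ∪ {u, v} →
      ¬ G.Adj a b := by
    intro a b h1 h2 h3 h4
    have h5 : a ∈ A := h1.resolve_right fun h => h4 (Or.inr h)
    have h6 : b ∈ B := h2.resolve_right fun h => h3 (Or.inr h)
    exact (hAB a h5 b h6).2
  rcases all x hx with ax | ax <;> rcases all y hy with ay | ay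
  · exact cA ⟨ax, ay⟩
  · exact cross x y ax ay (fun h => cA ⟨ax, h⟩) (fun h => cB ⟨h, ay⟩) hxy
  · exact cross y x ay ax (fun h => cA ⟨h, ay⟩) (fun h => cB ⟨ax, h⟩) hxy.symm
  · exact cB ⟨ax, ay⟩

lemma restrictTo_reachable_of_adj_adj {V : Type*} {G : SimpleGraph V} {S : Set V} {u v w : V}
    (hu : u ∈ S) (hv : v ∈ S) (hw : w ∈ S) (huw : G.Adj u w) (hwv : G.Adj w v) :
    (restrictTo G S).Reachable u v :=
  (show (restrictTo G S).Adj u w from ⟨huw, hu, hw⟩).reachable.trans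
    (show (restrictTo G S).Adj w v from ⟨hwv, hw, hv⟩).reachable

/-- In a chordal graph every cycle of length four has a chord. -/
lemma IsChordal.adj_of_four_cycle {V : Type*} {G : SimpleGraph V} (hG : IsChordal G)
    {a b c d : V} (hac : a ≠ c) (hbd : b ≠ d) (hab : G.Adj a b) (hbc : G.Adj b c)
    (hcd : G.Adj c d) (hda : G.Adj d a) (h : ¬ G.Adj a c) : G.Adj b d := by
  by_contra h'
  refine h (hG.adj_of_reachable hac (A := {b}) (B := {d}) ?_ ?_ ?_ ?_ ?_ ?_ ?_)
  · rintro _ rfl _ rfl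
    exact ⟨hbd, h'⟩
  · simpa using hab.ne
  · simpa using hda.ne'
  · simpa using hbc.ne'
  · simpa using hcd.ne
  · exact restrictTo_reachable_of_adj_adj (by simp) (by simp) (by simp) hab hbc
  · exact restrictTo_reachable_of_adj_adj (by simp) (by simp) (by simp) hda.symm hcd.symm

/-- A breadth-first leveling: adjacent vertices lie in the same or in consecutive levels, every
vertex of positive level has a neighbor one level below, and every component has at most one
vertex of level zero. -/
structure IsLeveling {V : Type*} (G : SimpleGraph V) (l : V → ℕ) : Prop where
  le_succ : ∀ u v, G.Adj u v → l u ≤ l v + 1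
  exists_adj : ∀ v n, l v = n + 1 → ∃ u, G.Adj u v ∧ l u = n
  eq_of_zero : ∀ u v, G.Reachable u v → l u = 0 → l v = 0 → u = v

lemma exists_isLeveling {V : Type*} (G : SimpleGraph V) : ∃ l, IsLeveling G l := by
  let root : V → V := fun v => (G.connectedComponentMk v).out
  have hroot : ∀ v, G.Reachable (root v) v := fun v =>
    SimpleGraph.ConnectedComponent.exact (Quot.out_eq (G.connectedComponentMk v))
  have hsame : ∀ u v, G.Reachable u v → root u = root v := by
    intro u v h
    simp only [root, SimpleGraph.ConnectedComponent.sound h]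
  refine ⟨fun v => G.dist (root v) v, ⟨?_, ?_, ?_⟩⟩
  · intro u v huv
    rw [hsame u v huv.reachable]
    have h1 := huv.symm.reachable.dist_triangle_right (root v)
    rwa [SimpleGraph.dist_eq_one_iff_adj.2 huv.symm] at h1
  · intro v n hv
    obtain ⟨p, hp⟩ := (hroot v).exists_walk_length_eq_dist
    have hnil : ¬ p.Nil := by
      rw [← SimpleGraph.Walk.length_eq_zero_iff]
      omega
    refine ⟨p.penultimate, p.adj_penultimate hnil, ?_⟩
    rw [hsame _ v (p.adj_penultimate hnil).reachable]
    have h1 := SimpleGraph.dist_le p.dropLast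
    have h2 := (p.adj_penultimate hnil).reachable.dist_triangle_right (root v)
    rw [SimpleGraph.dist_eq_one_iff_adj.2 (p.adj_penultimate hnil)] at h2
    simp only [SimpleGraph.Walk.length_dropLast] at h1
    omega
  · intro u v huv hu hv
    rw [← ((hroot u).dist_eq_zero_iff.1 hu), ← ((hroot v).dist_eq_zero_iff.1 hv), hsame u v huv]

/-- A breadth-first leveling of a chordal graph is shadow-complete: two vertices of the same level
that are joined through higher levels are adjacent. -/
lemma IsLeveling.adj_of_reachable {V : Type*} {G : SimpleGraph V} {l : V → ℕ}
    (hl : IsLeveling G l) (hG : IsChordal G) {u v : V} (huv : u ≠ v) (hluv : l u = l v)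
    (h : (restrictTo G ({x | l u < l x} ∪ {u, v})).Reachable u v) : G.Adj u v := by
  refine hG.adj_of_reachable huv (A := {x | l u < l x}) (B := {x | l x < l u})
    ?_ (by simp) (by simp) (by simp [hluv]) (by simp [hluv]) h ?_
  · intro a ha b hb
    simp only [Set.mem_ofPred_eq] at ha hb
    refine ⟨fun e => ?_, fun e => ?_⟩
    · subst e
      omega
    · have := hl.le_succ a b e
      omega
  · set K := restrictTo G ({x | l x < l u} ∪ {u, v})
    have down : ∀ n, ∀ x, l x = n → n < l u → ∃ y, l y = 0 ∧ K.Reachable y x := by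
      intro n
      induction n with
      | zero => exact fun x hx _ => ⟨x, hx, SimpleGraph.Reachable.refl x⟩
      | succ n ih =>
        intro x hx hn
        obtain ⟨z, hzx, hz⟩ := hl.exists_adj x n hx
        obtain ⟨y, hy, hyz⟩ := ih z hz (by omega)
        have : K.Adj z x := ⟨hzx, Or.inl (by simp; omega), Or.inl (by simp; omega)⟩
        exact ⟨y, hy, hyz.trans this.reachable⟩
    have down' : ∀ x, x = u ∨ x = v → ∃ y, l y = 0 ∧ K.Reachable y x := by
      intro x hx
      have hlx : l x = l u := by
        rcases hx with rfl | rfl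
        exacts [rfl, hluv.symm]
      rcases hn : l x with _ | n
      · exact ⟨x, hn, SimpleGraph.Reachable.refl x⟩
      · obtain ⟨z, hzx, hz⟩ := hl.exists_adj x n hn
        obtain ⟨y, hy, hyz⟩ := down n z hz (by omega)
        have : K.Adj z x := ⟨hzx, Or.inl (by simp; omega), Or.inr hx⟩
        exact ⟨y, hy, hyz.trans this.reachable⟩
    obtain ⟨y, hy, hyu⟩ := down' u (Or.inl rfl)
    obtain ⟨z, hz, hzv⟩ := down' v (Or.inr rfl)
    have hyz : y = z := hl.eq_of_zero y z
      (((hyu.mono (restrictTo_le _ _)).trans (h.mono (restrictTo_le _ _))).trans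
        (hzv.mono (restrictTo_le _ _)).symm) hy hz
    subst hyz
    exact hyu.symm.trans hzv

/-- A clique in a positive level of a chordal graph has a common neighbor one level below. -/
lemma IsLeveling.exists_common_neighbor {V : Type*} [DecidableEq V] {G : SimpleGraph V}
    {l : V → ℕ} (hl : IsLeveling G l) (hG : IsChordal G) {n : ℕ} (s : Finset V)
    (hs : G.IsClique (s : Set V)) (hn : ∀ x ∈ s, l x = n + 1) (hne : s.Nonempty) :
    ∃ v, l v = n ∧ ∀ x ∈ s, G.Adj v x := by
  induction hne using Finset.Nonempty.cons_induction with
  | singleton x =>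
    obtain ⟨v, hv, hvn⟩ := hl.exists_adj x n (hn x (by simp))
    exact ⟨v, hvn, by simpa using hv⟩
  | cons x s hx hne ih =>
    obtain ⟨v, hvn, hv⟩ := ih (hs.subset (by simp)) fun y hy => hn y (by simp [hy])
    by_cases hvx : G.Adj v x
    · refine ⟨v, hvn, fun y hy => ?_⟩
      rcases Finset.mem_cons.1 hy with rfl | hy
      exacts [hvx, hv y hy]
    obtain ⟨w, hw, hwn⟩ := hl.exists_adj x n (hn x (by simp))
    have hvw : v ≠ w := fun e => hvx (e ▸ hw)
    have hlx := hn x (by simp)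
    have hxs : ∀ y ∈ s, G.Adj y x := fun y hy =>
      hs (by simp [hy]) (by simp) fun e => hx (e ▸ hy)
    have hadj : G.Adj v w := by
      obtain ⟨y, hy⟩ := hne
      have hly := hn y (by simp [hy])
      have mx : x ∈ {z | l v < l z} ∪ {v, w} := Or.inl (by simp; omega)
      have my : y ∈ {z | l v < l z} ∪ {v, w} := Or.inl (by simp; omega)
      exact hl.adj_of_reachable hG hvw (hvn.trans hwn.symm)
        ((restrictTo_reachable_of_adj_adj (by simp) mx my (hv y hy) (hxs y hy)).trans
          (show (restrictTo G _).Adj x w from ⟨hw.symm, mx, by simp⟩).reachable)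
    refine ⟨w, hwn, fun y hy => ?_⟩
    rcases Finset.mem_cons.1 hy with rfl | hy
    · exact hw
    · refine (hG.adj_of_four_cycle (a := v) (b := y) (c := x) (d := w) ?_ ?_ (hv y hy) (hxs y hy)
        hw.symm hadj.symm hvx).symm
      · rintro rfl
        omega
      · rintro rfl
        have := hn y (by simp [hy])
        omega

/-- The graph `G` with only the edges inside a level of `l` kept. -/
def levelGraph {V : Type*} (G : SimpleGraph V) (l : V → ℕ) : SimpleGraph V where
  Adj x y := G.Adj x y ∧ l x = l y
  symm := ⟨fun _ _ h => ⟨h.1.symm, h.2.symm⟩⟩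
  loopless := ⟨fun _ h => h.1.ne rfl⟩

lemma levelGraph_le {V : Type*} (G : SimpleGraph V) (l : V → ℕ) : levelGraph G l ≤ G :=
  fun _ _ h => h.1

lemma eq_of_mem_support_levelGraph {V : Type*} {G : SimpleGraph V} {l : V → ℕ} {u v : V}
    (p : (levelGraph G l).Walk u v) : ∀ x ∈ p.support, l x = l u := by
  induction p with
  | nil => simp
  | cons h p ih =>
    intro x hx
    rw [SimpleGraph.Walk.support_cons, List.mem_cons] at hx
    rcases hx with rfl | hx
    · rfl
    · rw [ih x hx, h.2]

lemma IsChordal.levelGraph {V : Type*} {G : SimpleGraph V} (hG : IsChordal G) (l : V → ℕ) :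
    IsChordal (levelGraph G l) := by
  intro v p hp h4
  obtain ⟨x, y, hx, hy, hxy, hne⟩ := hG v (p.mapLe (levelGraph_le G l)) (hp.mapLe _) (by simpa)
  rw [SimpleGraph.Walk.support_mapLe_eq_support] at hx hy
  rw [SimpleGraph.Walk.edges_mapLe_eq_edges] at hne
  exact ⟨x, y, hx, hy, ⟨hxy, by
    rw [eq_of_mem_support_levelGraph p x hx, eq_of_mem_support_levelGraph p y hy]⟩, hne⟩

lemma IsLeveling.card_le_of_isClique {V : Type*} [DecidableEq V] {G : SimpleGraph V} {l : V → ℕ}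
    (hl : IsLeveling G l) (hG : IsChordal G) {k : ℕ}
    (hk : ∀ s : Finset V, G.IsClique (s : Set V) → s.card ≤ k + 1 + 1) (s : Finset V)
    (hs : (levelGraph G l).IsClique (s : Set V)) : s.card ≤ k + 1 := by
  rcases s.eq_empty_or_nonempty with rfl | hne
  · simp
  have hsG : G.IsClique (s : Set V) := hs.mono (levelGraph_le G l)
  obtain ⟨x, hx⟩ := hne
  have hlev : ∀ y ∈ s, l y = l x := by
    intro y hy
    by_cases e : y = x
    · rw [e]
    · exact (hs hy hx e).2
  rcases hn : l x with _ | n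
  · refine le_trans (Finset.card_le_one.2 fun a ha b hb => ?_) (by omega)
    by_contra e
    exact e (hl.eq_of_zero a b (hsG ha hb e).reachable ((hlev a ha).trans hn)
      ((hlev b hb).trans hn))
  · obtain ⟨v, hv, hvs⟩ := hl.exists_common_neighbor hG s hsG
      (fun y hy => (hlev y hy).trans hn) ⟨x, hx⟩
    have h1 := hk (insert v s) (by
      rw [Finset.coe_insert]
      exact hsG.insert fun y hy _ => hvs y hy)
    rw [Finset.card_insert_of_notMem fun h => (hvs v h).ne rfl] at h1
    omega

lemma restrictTo_reachable_of_isChain {V : Type*} {G : SimpleGraph V} {S : Set V} {b : V}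
    (hb : b ∈ S) : ∀ (m : List V) (a : V), a ∈ S → (∀ x ∈ m, x ∈ S) →
      List.IsChain G.Adj (a :: (m ++ [b])) → (restrictTo G S).Reachable a b := by
  intro m
  induction m with
  | nil =>
    intro a ha _ h
    have : G.Adj a b := by simpa using h
    exact (show (restrictTo G S).Adj a b from ⟨this, ha, hb⟩).reachable
  | cons c m ih =>
    intro a ha hm h
    rw [List.cons_append, List.isChain_cons_cons] at h
    have hc := hm c (by simp)
    exact (show (restrictTo G S).Adj a c from ⟨h.1, ha, hc⟩).reachable.trans
      (ih c hc (fun x hx => hm x (by simp [hx])) h.2)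

/-- In a chordal graph, the vertices of lowest level on a path form a path. -/
lemma IsLeveling.isChain_filter {V : Type*} {G : SimpleGraph V} {l : V → ℕ}
    (hl : IsLeveling G l) (hG : IsChordal G) {k : ℕ} (p : List V) (hp : p.IsChain G.Adj)
    (hnd : p.Nodup) (hk : ∀ x ∈ p, k ≤ l x) :
    (p.filter fun x => l x = k).IsChain (levelGraph G l).Adj := by
  induction p with
  | nil => simp
  | cons a p ih =>
    have ih := ih hp.tail (List.nodup_cons.1 hnd).2 fun x hx => hk x (by simp [hx])
    by_cases ha : l a = k
    · rw [List.filter_cons_of_pos (by simpa using ha)]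
      rcases hf : p.filter fun x => l x = k with _ | ⟨b, r⟩
      · simp
      · rw [hf] at ih
        rw [List.isChain_cons_cons]
        refine ⟨?_, ih⟩
        obtain ⟨m, r', rfl, hm, hb, -⟩ := List.filter_eq_cons_iff.1 hf
        have hb : l b = k := by simpa using hb
        refine ⟨hl.adj_of_reachable hG ?_ (ha.trans hb.symm) ?_, ha.trans hb.symm⟩
        · rintro rfl
          simp at hnd
        · refine restrictTo_reachable_of_isChain (by simp) m a (by simp) (fun x hx => ?_) ?_
          · left
            have h1 := hk x (by simp [hx])
            have h2 : l x ≠ k := by simpa using hm x hx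
            simp only [Set.mem_ofPred_eq]
            omega
          · rw [List.isChain_cons_split] at hp
            exact hp.1
    · rw [List.filter_cons_of_neg (by simpa using ha)]
      exact ih

/-- A chordal graph without cliques on `t + 2` vertices has a coloring with `4 ^ t` colors in which
no path, given as a list of vertices, is colored repetitively. -/
lemma IsChordal.exists_coloring {V : Type*} [DecidableEq V] (t : ℕ) {G : SimpleGraph V}
    (hG : IsChordal G) (ht : ∀ s : Finset V, G.IsClique (s : Set V) → s.card ≤ t + 1) :
    ∃ c : V → Fin (4 ^ t), ∀ p : List V, p.IsChain G.Adj → p.Nodup →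
      ¬ IsRepetition (p.map c) := by
  induction t generalizing G with
  | zero =>
    refine ⟨fun _ => 0, ?_⟩
    rintro p hp - ⟨w, hw, h⟩
    have hlen := congrArg List.length h
    have hw' := List.length_pos_of_ne_nil hw
    rw [List.length_map, List.length_append] at hlen
    rcases p with _ | ⟨a, _ | ⟨b, p⟩⟩
    · simp at hlen; omega
    · simp at hlen; omega
    · have hab : G.Adj a b := by
        rw [List.isChain_cons_cons] at hp
        exact hp.1
      have h1 := ht {a, b} (by
        rw [Finset.coe_pair, SimpleGraph.isClique_pair]
        exact fun _ => hab)
      rw [Finset.card_pair hab.ne] at h1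
      omega
  | succ t ih =>
    obtain ⟨l, hl⟩ := exists_isLeveling G
    obtain ⟨c, hc⟩ := ih (hG.levelGraph l) (hl.card_le_of_isClique hG ht)
    obtain ⟨q, hq, hs⟩ := exists_fin_four_squareFree
    let e : Fin (4 ^ t) × Fin 4 ≃ Fin (4 ^ (t + 1)) :=
      finProdFinEquiv.trans (finCongr (pow_succ 4 t).symm)
    refine ⟨fun v => e (c v, q (l v)), ?_⟩
    rintro p hp hnd ⟨w, hw, h⟩
    obtain ⟨p₁, p₂, rfl, h1, h2⟩ := List.map_eq_append_iff.1 h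
    have hlen1 : p₁.length = w.length := by rw [← h1, List.length_map]
    have hlen2 : p₂.length = w.length := by rw [← h2, List.length_map]
    have hw' := List.length_pos_of_ne_nil hw
    have hcol : ∀ i (hi : i < w.length), c p₁[i] = c p₂[i] ∧ q (l p₁[i]) = q (l p₂[i]) := by
      intro i hi
      have h3 : (p₁.map fun v => e (c v, q (l v)))[i]'(by simpa [hlen1]) =
          (p₂.map fun v => e (c v, q (l v)))[i]'(by simpa [hlen2]) := by
        simp only [h1, h2]
      simpa using h3
    let f : ℕ → ℕ := fun i => ((p₁ ++ p₂).map l).getD i 0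
    have hf1 : ∀ i (hi : i < w.length), f i = l p₁[i] := by
      intro i hi
      simp [f, List.getElem?_append, hlen1, hi]
    have hf2 : ∀ i (hi : i < w.length), f (i + w.length) = l p₂[i] := by
      intro i hi
      simp [f, List.getElem?_append, hlen1, hlen2, hi]
    have hstep : ∀ i, i + 1 < 2 * w.length → f (i + 1) ≤ f i + 1 ∧ f i ≤ f (i + 1) + 1 := by
      intro i hi
      have hi' : i + 1 < (p₁ ++ p₂).length := by
        rw [List.length_append]
        omega
      have hadj := hp.getElem i hi'
      have e1 : f i = l (p₁ ++ p₂)[i] := by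
        simp only [f, List.getD_eq_getElem?_getD, List.getElem?_map]
        rw [List.getElem?_eq_getElem (by omega)]
        rfl
      have e2 : f (i + 1) = l (p₁ ++ p₂)[i + 1] := by
        simp only [f, List.getD_eq_getElem?_getD, List.getElem?_map]
        rw [List.getElem?_eq_getElem (by omega)]
        rfl
      rw [e1, e2]
      exact ⟨hl.le_succ _ _ hadj.symm, hl.le_succ _ _ hadj⟩
    have hlev := lazy_walk_repetition hq hs hstep fun i hi => by
      rw [hf1 i hi, hf2 i hi]
      exact (hcol i hi).2
    have hmap : (p₁.map fun v => (c v, l v)) = p₂.map fun v => (c v, l v) := by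
      refine List.ext_getElem (by simp [hlen1, hlen2]) fun i hi hi' => ?_
      have hi : i < w.length := by simpa [hlen1] using hi
      rw [List.getElem_map, List.getElem_map, (hcol i hi).1, ← hf1 i hi, ← hf2 i hi, hlev i hi]
    obtain ⟨x, hx, hmin⟩ : ∃ x ∈ p₁ ++ p₂, ∀ y ∈ p₁ ++ p₂, l x ≤ l y := by
      have hne : (p₁ ++ p₂).toFinset.Nonempty := by
        rw [List.toFinset_nonempty_iff]
        intro e
        rw [List.append_eq_nil_iff] at e
        rw [e.1] at hlen1
        simp at hlen1
        omega
      obtain ⟨x, hx, hmin⟩ := Finset.exists_min_image _ l hne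
      exact ⟨x, List.mem_toFinset.1 hx, fun y hy => hmin y (List.mem_toFinset.2 hy)⟩
    have hfilter : ∀ r : List V, (r.filter fun y => l y = l x).map c =
        ((r.map fun v => (c v, l v)).filter fun a => a.2 = l x).map Prod.fst := by
      intro r
      rw [List.filter_map, List.map_map]
      rfl
    have hsame : (p₁.filter fun y => l y = l x).map c = (p₂.filter fun y => l y = l x).map c := by
      rw [hfilter, hfilter, hmap]
    refine hc ((p₁ ++ p₂).filter fun y => l y = l x)
      (hl.isChain_filter hG _ hp hnd hmin) (hnd.filter _)
      ⟨(p₁.filter fun y => l y = l x).map c, fun e => ?_, ?_⟩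
    · have e2 := hsame ▸ e
      rw [List.map_eq_nil_iff, List.filter_eq_nil_iff] at e e2
      rcases List.mem_append.1 hx with h3 | h3
      · simpa using e x h3
      · simpa using e2 x h3
    · rw [List.filter_append, List.map_append, ← hsame]

lemma isChordal_top (V : Type*) : IsChordal (⊤ : SimpleGraph V) := by
  intro v p hp h4
  have inj : ∀ i j, i + 1 ≤ p.length → j + 1 ≤ p.length → p.getVert i = p.getVert j → i = j :=
    fun i j hi hj h => hp.getVert_injOn' (Nat.le_sub_one_of_lt hi) (Nat.le_sub_one_of_lt hj) h
  refine ⟨p.getVert 0, p.getVert 2, p.getVert_mem_support 0, p.getVert_mem_support 2, ?_, ?_⟩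
  · rw [SimpleGraph.top_adj]
    intro e
    have := inj 0 2 (by omega) (by omega) e
    omega
  · rw [SimpleGraph.Walk.mk_mem_edges_iff_exists]
    rintro ⟨i, hi, e⟩
    rcases Sym2.eq_iff.1 e with ⟨e1, e2⟩ | ⟨e1, e2⟩
    · obtain rfl := inj i 0 hi (by omega) e1
      have := inj 1 2 (by omega) (by omega) e2
      omega
    · obtain rfl := inj i 2 hi (by omega) e1
      have := inj 3 0 (by omega) (by omega) e2
      omega

/-- **Barát–Varjú; Kündgen–Pelsmajer.** If `G` is a graph of tree-width `t`, then its
Thue chromatic number satisfies `π(G) ≤ 4^t`. -/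
theorem thueNumber_le_four_pow_treewidth {V : Type} [Fintype V] [DecidableEq V]
    (G : SimpleGraph V) (t : ℕ) (ht : treewidth G = t) :
    thueNumber G ≤ 4 ^ t := by
  have hne : {k : ℕ | ∃ H : SimpleGraph V, G ≤ H ∧ IsChordal H ∧
      ∀ s : Finset V, H.IsClique (s : Set V) → s.card ≤ k + 1}.Nonempty :=
    ⟨Fintype.card V, ⊤, le_top, isChordal_top V, fun s _ => s.card_le_univ.trans (by omega)⟩
  obtain ⟨H, hGH, hH, hcl⟩ := Nat.sInf_mem hne
  change ∀ s : Finset V, H.IsClique (s : Set V) → s.card ≤ treewidth G + 1 at hcl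
  rw [ht] at hcl
  obtain ⟨c, hc⟩ := hH.exists_coloring t hcl
  exact Nat.sInf_le ⟨c, fun u v p hp =>
    hc p.support (p.isChain_adj_support.imp fun _ _ h => hGH h) hp.support_nodup⟩
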